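/- Let m and n be distinct positive integers, let s^(1) and s^(2) be nonempty finite sequences of positive integers, and let t be a nonempty finite sequence with values in {m, n}. Then C_{m,n}(s^(1) s^(2), t) = C_{m,n}(s^(2), C_{m,n}(s^(1), t)), where s^(1) s^(2) denotes concatenation. -/

import Mathlib

/-- `expand1 m n x s` : the expansion `E_{m,n}(s, x)` of the finite sequence `s` with the
single starting point `x ∈ {m, n}`: the unique sequence with values in `{m, n}`, first term
`x`, and run-lengths `s`. -/
def expand1 (m n : ℕ) : ℕ → List ℕ → List ℕ
  | _, [] => []
  | x, a :: l => List.replicate a x ++ expand1 m n (m + n - x) l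

/-- `expand m n s t` : the expansion `E_{m,n}(s, t)` of the finite sequence `s` with the
finite sequence of starting points `t` (values in `{m, n}`), defined by
`E_{m,n}(s, t₁ t') = E_{m,n}(E_{m,n}(s, t₁), t')`. -/
def expand (m n : ℕ) : List ℕ → List ℕ → List ℕ
  | s, [] => s
  | s, x :: t => expand m n (expand1 m n x s) t

/-- `torsion m n s t` : the torsion `C_{m,n}(s, t)`, the sequence of the same length as `t`
whose `k`-th term equals `m + n` minus the last term of `E_{m,n}(s, t⁽ᵏ⁾)`, where `t⁽ᵏ⁾`
consists of the first `k` terms of `t`. -/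
def torsion (m n : ℕ) (s t : List ℕ) : List ℕ :=
  (List.range t.length).map fun k => m + n - (expand m n s (t.take (k + 1))).getLastD 0

theorem expand1_ne_nil (m n x : ℕ) (s : List ℕ) (hs : s ≠ []) (hp : ∀ a ∈ s, 0 < a) :
    expand1 m n x s ≠ [] := by
  cases s with
  | nil => exact absurd rfl hs
  | cons a l =>
    have := hp a (by simp)
    simp only [expand1, ne_eq, List.append_eq_nil_iff, List.replicate_eq_nil_iff]
    omega

theorem expand1_mem (m n : ℕ) (s : List ℕ) : ∀ x, (x = m ∨ x = n) →
    ∀ a ∈ expand1 m n x s, a = m ∨ a = n := by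
  induction s with
  | nil => intro x _ a ha; simp [expand1] at ha
  | cons b l ih =>
    intro x hx a ha
    simp only [expand1, List.mem_append, List.mem_replicate] at ha
    rcases ha with ha | ha
    · rw [ha.2]; exact hx
    · exact ih (m + n - x) (by omega) a ha

theorem getLastD_append_ne (l l' : List ℕ) (h : l' ≠ []) (d : ℕ) :
    (l ++ l').getLastD d = l'.getLastD d := by
  rw [List.getLastD_eq_getLast?, List.getLastD_eq_getLast?, List.getLast?_append_of_ne_nil _ h]

theorem expand1_append (m n : ℕ) (s₂ s₁ : List ℕ) : ∀ x, s₁ ≠ [] → (∀ a ∈ s₁, 0 < a) →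
    expand1 m n x (s₁ ++ s₂) =
      expand1 m n x s₁ ++ expand1 m n (m + n - (expand1 m n x s₁).getLastD 0) s₂ := by
  induction s₁ with
  | nil => intro x h; exact absurd rfl h
  | cons a l ih =>
    intro x _ hp
    have ha := hp a (by simp)
    have hl : ∀ b ∈ l, 0 < b := fun b hb => hp b (by simp [hb])
    by_cases h : l = []
    · subst h
      obtain ⟨k, rfl⟩ : ∃ k, a = k + 1 := ⟨a - 1, by omega⟩
      have : (List.replicate (k + 1) x).getLastD 0 = x := by
        rw [List.getLastD_eq_getLast?, List.getLast?_replicate]; simp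
      simp only [expand1, List.cons_append, List.nil_append, List.append_nil, this]
    · have hne := expand1_ne_nil m n (m + n - x) l h hl
      simp only [expand1, List.cons_append]
      rw [getLastD_append_ne _ _ hne, ih _ h hl, List.append_assoc]

theorem torsion_cons (m n : ℕ) (s : List ℕ) (x : ℕ) (t : List ℕ) :
    torsion m n s (x :: t) =
      (m + n - (expand1 m n x s).getLastD 0) :: torsion m n (expand1 m n x s) t := by
  simp [torsion, List.range_succ_eq_map, expand, Function.comp_def]

theorem torsion_append_aux (m n : ℕ) (hm : 0 < m) (hn : 0 < n) (t : List ℕ) :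
    ∀ s₁ s₂ : List ℕ, s₁ ≠ [] → s₂ ≠ [] → (∀ a ∈ s₁, 0 < a) → (∀ a ∈ s₂, 0 < a) →
    (∀ a ∈ t, a = m ∨ a = n) →
    torsion m n (s₁ ++ s₂) t = torsion m n s₂ (torsion m n s₁ t) := by
  induction t with
  | nil => intros; simp [torsion]
  | cons x t ih =>
    intro s₁ s₂ h₁ h₂ p₁ p₂ hv
    have hx := hv x (by simp)
    have e₁ := expand1_ne_nil m n x s₁ h₁ p₁
    have hlast : (expand1 m n x s₁).getLastD 0 = m ∨ (expand1 m n x s₁).getLastD 0 = n := by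
      rw [List.getLastD_eq_getLast?, List.getLast?_eq_some_getLast e₁]
      exact expand1_mem m n s₁ x hx _ (List.getLast_mem e₁)
    rw [torsion_cons, torsion_cons, torsion_cons, expand1_append m n s₂ s₁ x h₁ p₁]
    set y := m + n - (expand1 m n x s₁).getLastD 0 with hy
    have hyv : y = m ∨ y = n := by omega
    have e₂ := expand1_ne_nil m n y s₂ h₂ p₂
    have pos : ∀ a, (a = m ∨ a = n) → 0 < a := by intro a; omega
    rw [getLastD_append_ne _ _ e₂, ih _ _ e₁ e₂
      (fun a ha => pos a (expand1_mem m n s₁ x hx a ha))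
      (fun a ha => pos a (expand1_mem m n s₂ y hyv a ha))
      (fun a ha => hv a (by simp [ha]))]


/-- `C_{m,n}(s⁽¹⁾ s⁽²⁾, t) = C_{m,n}(s⁽²⁾, C_{m,n}(s⁽¹⁾, t))`. -/
theorem torsion_append_left (m n : ℕ) (hm : 0 < m) (hn : 0 < n) (hmn : m ≠ n)
    (s₁ s₂ : List ℕ) (hs₁ : s₁ ≠ []) (hs₂ : s₂ ≠ [])
    (hs₁p : ∀ a ∈ s₁, 0 < a) (hs₂p : ∀ a ∈ s₂, 0 < a)
    (t : List ℕ) (ht : t ≠ []) (htv : ∀ a ∈ t, a = m ∨ a = n) :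
    torsion m n (s₁ ++ s₂) t = torsion m n s₂ (torsion m n s₁ t) := by
  exact torsion_append_aux m n hm hn t s₁ s₂ hs₁ hs₂ hs₁p hs₂p htv
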